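/- The map T is measure preserving on the area polytope: the pushforward of λ_n under T equals λ_n; equivalently, λ_n(T^{-1}(U)) = λ_n(U) for every Borel set U ⊆ ℝ^{n−1}. -/

import Mathlib

open MeasureTheory Finset Filter

noncomputable section

/-- `sc x = max (1 - |x|) 0`. -/
def sc (x : ℝ) : ℝ := max (1 - |x|) 0

/-- Extend `a : Fin k → ℝ` (thought of as coordinates `a_1, …, a_k`) to an ℕ-indexed
vector with the convention `a_0 = 0` (and value `0` beyond index `k`). -/
def cext {k : ℕ} (a : Fin k → ℝ) (i : ℕ) : ℝ :=
  if h : 1 ≤ i ∧ i ≤ k then a ⟨i - 1, by omega⟩ else 0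

/-- The area polytope `A_n ⊆ ℝ^{n-1}`. -/
def areaPoly (n : ℕ) : Set (Fin (n - 1) → ℝ) :=
  {a | ∀ i < n - 1, 0 ≤ cext a (i + 1) ∧ cext a (i + 1) ≤ cext a i + 1}

/-- The bounce polytope `B_n ⊆ ℝ^{n-1}`. -/
def bouncePoly (n : ℕ) : Set (Fin (n - 1) → ℝ) :=
  {b | ∀ i < n - 1, cext b i ≤ cext b (i + 1) ∧ cext b (i + 1) ≤ cext b i + 1}

/-- `area(a) = ∑_{i=0}^{n-1} a_i`. -/
def area (n : ℕ) (a : Fin (n - 1) → ℝ) : ℝ := ∑ i ∈ Finset.range n, cext a i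

/-- `dinv(a) = ∑_{0 ≤ i < j ≤ n-1} sc(a_i - a_j)`. -/
def dinv (n : ℕ) (a : Fin (n - 1) → ℝ) : ℝ :=
  ∑ j ∈ Finset.range n, ∑ i ∈ Finset.range j, sc (cext a i - cext a j)

/-- The `q,t`-Catalan measure `μ_n`: pushforward of Lebesgue measure restricted to `A_n`
under `a ↦ (dinv a, area a)`. -/
def qtMeasure (n : ℕ) : Measure (ℝ × ℝ) :=
  Measure.map (fun a => (dinv n a, area n a)) (volume.restrict (areaPoly n))

/-- The map `f` sending a bounce vector to the area vector of the same path. -/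
def fmap (n : ℕ) (b : Fin (n - 1) → ℝ) : Fin (n - 1) → ℝ :=
  fun j => ∑ i ∈ Finset.range (j.1 + 1), sc (cext b (j.1 + 1) - cext b i)

/-- The nondecreasing rearrangement of `a`. -/
def sortVec (n : ℕ) (a : Fin (n - 1) → ℝ) : Fin (n - 1) → ℝ := a ∘ Tuple.sort a

/-- The map `T : a ↦ f(sort(a))`. -/
def Tmap (n : ℕ) (a : Fin (n - 1) → ℝ) : Fin (n - 1) → ℝ := fmap n (sortVec n a)


lemma cext_zero {k : ℕ} (a : Fin k → ℝ) : cext a 0 = 0 := by simp [cext]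

lemma cext_succ {k : ℕ} (a : Fin k → ℝ) (i : ℕ) (h : i < k) : cext a (i+1) = a ⟨i, h⟩ := by
  unfold cext; rw [dif_pos ⟨by omega, by omega⟩]; simp

lemma cext_fin {k : ℕ} (a : Fin k → ℝ) (i : Fin k) : cext a (i.1+1) = a i := cext_succ a i.1 i.2

lemma cext_insertNth {m : ℕ} (k : Fin (m+1)) (x : ℝ) (a : Fin m → ℝ) (i : ℕ) :
    cext (Fin.insertNth (α := fun _ => ℝ) k x a) i =
      if i ≤ k.1 then cext a i else if i = k.1 + 1 then x else cext a (i-1) := by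
  rcases i with _ | i
  · simp [cext_zero]
  by_cases hi : i < m + 1
  · rw [cext_succ _ _ hi]
    rcases lt_trichotomy i k.1 with h | h | h
    · have h1 : i < m := by omega
      have : (⟨i, hi⟩ : Fin (m+1)) = k.succAbove ⟨i, h1⟩ := by
        rw [Fin.succAbove_of_castSucc_lt _ _ (by simpa [Fin.lt_def] using h)]; rfl
      rw [this, Fin.insertNth_apply_succAbove, if_pos (by omega), cext_succ _ _ h1]
    · have : (⟨i, hi⟩ : Fin (m+1)) = k := Fin.ext h
      rw [this, Fin.insertNth_apply_same, if_neg (by omega), if_pos (by omega)]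
    · obtain ⟨j, rfl⟩ : ∃ j, i = j + 1 := ⟨i - 1, by omega⟩
      have h1 : j < m := by omega
      have : (⟨j+1, hi⟩ : Fin (m+1)) = k.succAbove ⟨j, h1⟩ := by
        rw [Fin.succAbove_of_le_castSucc _ _ (by simp [Fin.le_def]; omega)]; rfl
      rw [this, Fin.insertNth_apply_succAbove, if_neg (by omega), if_neg (by omega)]
      simp only [Nat.add_sub_cancel]
      rw [cext_succ _ _ h1]
  · have := k.2
    rw [if_neg (by omega), if_neg (by omega)]
    unfold cext
    rw [dif_neg (by omega), dif_neg (by omega)]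

abbrev AA (m : ℕ) : Set (Fin m → ℝ) := areaPoly (m+1)
abbrev TT (m : ℕ) : (Fin m → ℝ) → (Fin m → ℝ) := Tmap (m+1)
abbrev SS (m : ℕ) : (Fin m → ℝ) → (Fin m → ℝ) := sortVec (m+1)

/-- insertion -/
abbrev ins {m : ℕ} (k : Fin (m+1)) (x : ℝ) (a : Fin m → ℝ) : Fin (m+1) → ℝ :=
  Fin.insertNth (α := fun _ => ℝ) k x a

lemma mem_AA {m : ℕ} (a : Fin m → ℝ) :
    a ∈ AA m ↔ ∀ i < m, 0 ≤ cext a (i + 1) ∧ cext a (i + 1) ≤ cext a i + 1 := Iff.rfl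

lemma cext_le {m : ℕ} (a : Fin m → ℝ) (x : ℝ) (h : ∀ j, a j ≤ x) (i : ℕ) (hi : i < m) :
    cext a (i+1) ≤ x := by rw [cext_succ _ _ hi]; exact h _

lemma ins_mem {m : ℕ} (k : Fin (m+1)) (x : ℝ) (a : Fin m → ℝ) (h : k = Fin.last m ∨ ∀ j, a j ≤ x) :
    ins k x a ∈ AA (m+1) ↔ a ∈ AA m ∧ 0 ≤ x ∧ x ≤ cext a k.1 + 1 := by
  rw [mem_AA, mem_AA]
  have hk := k.2
  have hx : ∀ i, k.1 ≤ i → i < m → cext a (i+1) ≤ x := by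
    rcases h with h | h
    · subst h; intro i h1 h2; simp at h1; omega
    · intro i _ hi; exact cext_le a x h i hi
  simp only [ins, cext_insertNth]
  constructor
  · intro H
    have h0 := H k.1 (by omega)
    simp at h0
    refine ⟨fun i hi => ?_, h0⟩
    rcases lt_trichotomy i k.1 with h | h | h
    · have := H i (by omega)
      simpa [show i + 1 ≤ k.1 by omega, show i ≤ k.1 by omega] using this
    · have h1 := H (i+1) (by omega)
      have := hx i (by omega) hi
      simp [show ¬ (i + 1 + 1 ≤ k.1) by omega, show ¬ i + 1 = k.1 by omega] at h1
      exact ⟨h1.1, by rw [h] at this ⊢; linarith [h0.2]⟩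
    · have h1 := H (i+1) (by omega)
      simpa [show ¬ (i + 1 + 1 ≤ k.1) by omega, show ¬ i + 1 = k.1 by omega,
        show ¬ (i + 1 ≤ k.1) by omega, show ¬ i = k.1 by omega] using h1
  · rintro ⟨H, h0, h1⟩ i hi
    rcases lt_trichotomy i k.1 with h | h | h
    · simpa [show i + 1 ≤ k.1 by omega, show i ≤ k.1 by omega] using H i (by omega)
    · simpa [h] using ⟨h0, h1⟩
    · obtain ⟨j, rfl⟩ : ∃ j, i = j + 1 := ⟨i - 1, by omega⟩
      have h2 := H j (by omega)
      have h3 := hx j (by omega) (by omega)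
      rw [if_neg (by omega), if_neg (by omega), if_neg (by omega)]
      by_cases hj : j = k.1
      · rw [if_pos (by omega)]; simp only [Nat.add_sub_cancel]
        exact ⟨h2.1, by linarith⟩
      · rw [if_neg (by omega)]; simpa using h2

lemma sum_cext {m : ℕ} (a : Fin m → ℝ) (h : ℝ → ℝ) :
    ∑ i ∈ Finset.range (m+1), h (cext a i) = (∑ i, h (a i)) + h 0 := by
  rw [Finset.sum_range_succ', cext_zero, Finset.sum_range]
  simp only [cext_fin]

lemma SS_mono {m : ℕ} (a : Fin m → ℝ) : Monotone (SS m a) := Tuple.monotone_sort a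

lemma SS_eq {m : ℕ} (a : Fin m → ℝ) : SS m a = a ∘ Tuple.sort a := rfl

lemma sum_cext_SS {m : ℕ} (a : Fin m → ℝ) (h : ℝ → ℝ) :
    ∑ i ∈ Finset.range (m+1), h (cext (SS m a) i) = ∑ i ∈ Finset.range (m+1), h (cext a i) := by
  rw [sum_cext, sum_cext, SS_eq]
  congr 1
  exact Equiv.sum_comp (Tuple.sort a) (fun i => h (a i))

lemma SS_ins {m : ℕ} (k : Fin (m+1)) (x : ℝ) (a : Fin m → ℝ) (h : ∀ j, a j ≤ x) :
    SS (m+1) (ins k x a) = ins (Fin.last m) x (SS m a) := by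
  let τ : Equiv.Perm (Fin (m+1)) := (finSuccEquiv' (Fin.last m)).trans
    ((Equiv.optionCongr (Tuple.sort a)).trans (finSuccEquiv' k).symm)
  have hτ : ins k x a ∘ τ = ins (Fin.last m) x (SS m a) := by
    funext i
    refine Fin.lastCases ?_ (fun i => ?_) i
    · simp [τ, ins]
    · have : (finSuccEquiv' (Fin.last m)) i.castSucc = some i := by
        rw [← Fin.succAbove_last]; exact finSuccEquiv'_succAbove _ _
      simp [τ, ins, SS_eq, this]
  have hm : Monotone (ins k x a ∘ τ) := by
    rw [hτ]
    intro i j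
    refine Fin.lastCases ?_ (fun i => ?_) i <;> refine Fin.lastCases ?_ (fun j => ?_) j
    · simp
    · intro h; exact absurd h (not_le.2 (Fin.castSucc_lt_last j))
    · intro _; simp [ins, SS_eq, h]
    · intro hij; simp [ins]; exact SS_mono a (by simpa using hij)
  rw [← hτ]
  exact (Tuple.comp_sort_eq_comp_iff_monotone.2 hm).symm

lemma cext_TT {m : ℕ} (a : Fin m → ℝ) (j : ℕ) (hj : j < m) :
    cext (TT m a) (j+1) = ∑ i ∈ Finset.range (j+1), sc (cext (SS m a) (j+1) - cext (SS m a) i) := by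
  rw [cext_succ _ _ hj]; rfl

/-- the g function -/
def gg {m : ℕ} (a : Fin m → ℝ) (x : ℝ) : ℝ := ∑ i ∈ Finset.range (m+1), sc (x - cext a i)

lemma TT_ins {m : ℕ} (k : Fin (m+1)) (x : ℝ) (a : Fin m → ℝ) (h : ∀ j, a j ≤ x) :
    TT (m+1) (ins k x a) = ins (Fin.last m) (gg a x) (TT m a) := by
  funext i
  rw [← cext_fin (TT (m+1) _) i, ← cext_fin (ins _ _ _) i, cext_TT _ _ i.2, SS_ins k x a h]
  simp only [ins, cext_insertNth, Fin.val_last]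
  have hi := i.2
  by_cases hm : i.1 + 1 ≤ m
  · simp only [hm, if_true]
    rw [cext_TT _ _ (by omega)]
    refine Finset.sum_congr rfl fun j hj => ?_
    rw [if_pos (by simp at hj; omega)]
  · have e : i.1 = m := by omega
    simp only [e]
    simp only [show ¬ (m + 1 ≤ m) by omega, if_false, if_true, gg]
    rw [← sum_cext_SS a (fun t => sc (x - t))]
    refine Finset.sum_congr rfl fun j hj => ?_
    rw [if_pos (by simp at hj; omega)]

/-- max -/
def MM {m : ℕ} (a : Fin m → ℝ) : ℝ := cext (SS m a) m

lemma gg_MM {m : ℕ} (a : Fin m → ℝ) : gg a (MM a) = cext (TT m a) m + 1 := by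
  unfold gg
  rw [← sum_cext_SS a (fun t => sc (MM a - t)), Finset.sum_range_succ]
  have : sc (MM a - cext (SS m a) m) = 1 := by simp [MM, sc]
  rw [this]
  congr 1
  rcases m with _ | m
  · simp [cext_zero]
  · rw [cext_TT _ _ (by omega)]; rfl

lemma MM_le_iff {m : ℕ} (a : Fin m → ℝ) (ha : a ∈ AA m) (x : ℝ) :
    MM a ≤ x ↔ 0 ≤ x ∧ ∀ j, a j ≤ x := by
  rcases m with _ | m
  · simp [MM, cext_zero]
  · have h0 : 0 ≤ a 0 := by
      have := (ha 0 (by simp)).1; rwa [cext_succ _ _ (by simp)] at this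
    have e : MM a = SS (m+1) a (Fin.last m) := cext_succ _ _ (by omega)
    rw [e]
    constructor
    · intro h
      have h1 : ∀ j, a j ≤ x := by
        intro j
        refine le_trans ?_ h
        have := SS_mono a (Fin.le_last ((Tuple.sort a).symm j))
        simpa [SS_eq] using this
      exact ⟨h0.trans (h1 0), h1⟩
    · intro h; exact h.2 _

lemma MM_bound {m : ℕ} (a : Fin m → ℝ) (ha : a ∈ AA m) (i : ℕ) : cext a i ≤ MM a := by
  have := (MM_le_iff a ha _).1 le_rfl
  unfold cext
  split_ifs
  · exact this.2 _
  · exact this.1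

lemma sc_cont : Continuous sc := by unfold sc; fun_prop

lemma sc_of_nonneg (x : ℝ) (h : 0 ≤ x) : sc x = max (1 - x) 0 := by rw [sc, abs_of_nonneg h]

open Set in
lemma oneD (m : ℕ) (u : ℕ → ℝ) (M : ℝ) (hM : ∀ i, u i ≤ M) (g : ℝ → ℝ)
    (hg : g = fun x => ∑ i ∈ Finset.range m, sc (x - u i)) :
    Measure.map g (∑ i ∈ Finset.range m, (volume : Measure ℝ).restrict (Icc M (u i + 1)))
      = volume.restrict (Icc 0 (g M)) := by
  have gc : Continuous g := by
    rw [hg]; exact continuous_finsetSum _ fun i _ => sc_cont.comp (by fun_prop)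
  have gnn : ∀ x, 0 ≤ g x := fun x => by
    rw [hg]; exact Finset.sum_nonneg fun i _ => le_max_right _ _
  have gval : ∀ x, M ≤ x → g x = ∑ i ∈ Finset.range m, max (1 - (x - u i)) 0 := fun x hx => by
    rw [hg]; exact Finset.sum_congr rfl fun i _ => sc_of_nonneg _ (by linarith [hM i])
  have ganti : ∀ x y, M ≤ x → x ≤ y → g y ≤ g x := fun x y hx hy => by
    rw [gval x hx, gval y (hx.trans hy)]
    exact Finset.sum_le_sum fun i _ => max_le_max (by linarith) le_rfl
  have gstrict : ∀ x y, M ≤ x → x < y → 0 < g x → g y < g x := fun x y hx hy h0 => by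
    rw [gval x hx] at h0 ⊢
    rw [gval y (hx.trans hy.le)]
    obtain ⟨i, hi, hi0⟩ := Finset.exists_lt_of_sum_lt (s := Finset.range m) (f := fun _ => (0:ℝ)) (by simpa using h0)
    refine Finset.sum_lt_sum (fun i _ => max_le_max (by linarith) le_rfl) ⟨i, hi, ?_⟩
    have : 0 < 1 - (x - u i) := by simpa using hi0
    rw [max_eq_left this.le]
    exact max_lt (by linarith) this
  have g1 : g (M+1) = 0 := by
    rw [gval _ (by linarith)]
    exact Finset.sum_eq_zero fun i _ => max_eq_right (by linarith [hM i])
  have : IsFiniteMeasure (∑ i ∈ Finset.range m, (volume : Measure ℝ).restrict (Icc M (u i + 1))) := by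
    infer_instance
  have meas : ∀ X, M ≤ X → (∑ i ∈ Finset.range m, (volume : Measure ℝ).restrict (Icc M (u i + 1))) (Icc M X)
      = ENNReal.ofReal (g M - g X) := by
    intro X hX
    rw [Measure.finsetSum_apply, gval M le_rfl, gval X hX, ← Finset.sum_sub_distrib,
      ENNReal.ofReal_sum_of_nonneg]
    · refine Finset.sum_congr rfl fun i _ => ?_
      rw [Measure.restrict_apply measurableSet_Icc, Icc_inter_Icc, Real.volume_Icc]
      have := hM i
      simp only [max_self]
      by_cases h1 : M ≤ u i + 1
      · rw [max_eq_left (by linarith)]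
        congr 1
        rcases le_total X (u i + 1) with h2 | h2
        · rw [min_eq_left h2, max_eq_left (by linarith)]; ring
        · rw [min_eq_right h2, max_eq_right (by linarith)]; ring
      · push Not at h1
        rw [max_eq_right (by linarith), max_eq_right (by linarith), min_eq_right (by linarith),
          ENNReal.ofReal_of_nonpos (by linarith)]
        simp
    · intro i _
      exact sub_nonneg.2 (max_le_max (by linarith) le_rfl)
  have supp : ∀ S : Set ℝ, MeasurableSet S →
     (∑ i ∈ Finset.range m, (volume : Measure ℝ).restrict (Icc M (u i + 1))) S
      = (∑ i ∈ Finset.range m, (volume : Measure ℝ).restrict (Icc M (u i + 1))) (S ∩ Icc M (M+1)) := by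
    intro S hS
    rw [Measure.finsetSum_apply, Measure.finsetSum_apply]
    refine Finset.sum_congr rfl fun i _ => ?_
    rw [Measure.restrict_apply hS, Measure.restrict_apply (hS.inter measurableSet_Icc)]
    congr 1
    ext x
    have := hM i
    simp only [Set.mem_inter_iff, Set.mem_Icc]
    constructor
    · rintro ⟨a, b, c⟩; exact ⟨⟨a, b, by linarith⟩, b, c⟩
    · rintro ⟨⟨a, _⟩, b⟩; exact ⟨a, b⟩
  refine Measure.ext_of_Ici _ _ fun t => ?_
  rw [Measure.map_apply gc.measurable measurableSet_Ici, supp _ (gc.measurable measurableSet_Ici),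
    Measure.restrict_apply measurableSet_Ici]
  have e2 : Ici t ∩ Icc 0 (g M) = Icc (max t 0) (g M) := by
    ext x; simp only [Set.mem_inter_iff, Set.mem_Icc, Set.mem_Ici, max_le_iff]; tauto
  rw [e2, Real.volume_Icc]
  rcases le_or_gt t 0 with ht | ht
  · have : g ⁻¹' Ici t ∩ Icc M (M+1) = Icc M (M+1) := by
      apply Set.inter_eq_right.2; intro x _; exact ht.trans (gnn x)
    rw [this, meas _ (by linarith), g1, max_eq_right ht]
  · rw [max_eq_left ht.le]
    rcases lt_or_ge (g M) t with h | h
    · have : g ⁻¹' Ici t ∩ Icc M (M+1) = ∅ := by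
        ext x
        simp only [Set.mem_inter_iff, Set.mem_Icc, Set.mem_Ici, Set.mem_preimage,
          Set.mem_empty_iff_false, iff_false]
        rintro ⟨a, b, _⟩
        linarith [ganti M x le_rfl b]
      rw [this, measure_empty, ENNReal.ofReal_of_nonpos (by linarith)]
    · obtain ⟨X, hX, hXt⟩ : t ∈ g '' Icc M (M+1) :=
        intermediate_value_Icc' (by linarith) gc.continuousOn ⟨by rw [g1]; exact ht.le, h⟩
      have : g ⁻¹' Ici t ∩ Icc M (M+1) = Icc M X := by
        ext x
        simp only [Set.mem_inter_iff, Set.mem_Icc, Set.mem_Ici, Set.mem_preimage]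
        constructor
        · rintro ⟨a, b, c⟩
          refine ⟨b, not_lt.1 fun hlt => ?_⟩
          have := gstrict X x hX.1 hlt (by linarith)
          linarith
        · rintro ⟨b, c⟩
          exact ⟨by rw [← hXt]; exact ganti _ _ b c, b, c.trans hX.2⟩
      rw [this, meas _ hX.1, hXt]

lemma SS_meas (m : ℕ) : Measurable (SS m) := by
  refine measurable_pi_iff.2 fun j => measurable_of_Iic fun t => ?_
  have : (fun a => SS m a j) ⁻¹' Set.Iic t =
      (fun a : Fin m → ℝ => ∑ i, (if a i ≤ t then 1 else 0 : ℕ)) ⁻¹' Set.Ioi j.1 := by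
    ext a
    simp only [Set.mem_preimage, Set.mem_Iic, Set.mem_Ioi]
    rw [← Tuple.lt_card_le_iff_apply_le_of_monotone (SS_mono a), Finset.card_filter]
    have : ∑ i, (if SS m a i ≤ t then 1 else 0 : ℕ) = ∑ i, (if a i ≤ t then 1 else 0 : ℕ) :=
      Equiv.sum_comp (Tuple.sort a) (fun i => (if a i ≤ t then 1 else 0 : ℕ))
    rw [this]
  rw [this]
  refine (Finset.measurable_sum _ fun i _ => ?_) measurableSet_Ioi
  exact Measurable.ite (measurableSet_le (measurable_pi_apply i) measurable_const)
    measurable_const measurable_const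

lemma cext_meas {m : ℕ} (i : ℕ) : Measurable (fun a : Fin m → ℝ => cext a i) := by
  unfold cext
  split_ifs
  · exact measurable_pi_apply _
  · exact measurable_const

lemma TT_meas (m : ℕ) : Measurable (TT m) := by
  refine measurable_pi_iff.2 fun j => ?_
  have h : ∀ i, Measurable fun a : Fin m → ℝ => cext (SS m a) i :=
    fun i => (cext_meas i).comp (SS_meas m)
  change Measurable fun a : Fin m → ℝ =>
    ∑ i ∈ Finset.range (j.1 + 1), sc (cext (SS m a) (j.1 + 1) - cext (SS m a) i)
  exact Finset.measurable_sum _ fun i _ => sc_cont.measurable.comp ((h _).sub (h _))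

lemma AA_meas (m : ℕ) : MeasurableSet (AA m) := by
  have : AA m = ⋂ i, ⋂ (_ : i < m), {a | 0 ≤ cext a (i + 1) ∧ cext a (i + 1) ≤ cext a i + 1} := by
    ext a; simp [mem_AA]
  rw [this]
  refine MeasurableSet.iInter fun i => MeasurableSet.iInter fun _ => ?_
  exact (measurableSet_le measurable_const (cext_meas _)).inter
    (measurableSet_le (cext_meas _) ((cext_meas _).add measurable_const))

lemma ins_meas {m : ℕ} (k : Fin (m+1)) : Measurable (fun p : ℝ × (Fin m → ℝ) => ins k p.1 p.2) :=
  (MeasurableEquiv.piFinSuccAbove (fun _ => ℝ) k).symm.measurable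

lemma lint_ins {m : ℕ} (k : Fin (m+1)) (F : (Fin (m+1) → ℝ) → ENNReal) (hF : Measurable F) :
    ∫⁻ a, F a = ∫⁻ a : Fin m → ℝ, ∫⁻ x : ℝ, F (ins k x a) := by
  have := (volume_preserving_piFinSuccAbove (fun _ : Fin (m+1) => ℝ) k).symm
  rw [← this.lintegral_comp hF]
  exact lintegral_prod_symm' _ (hF.comp (ins_meas k))

lemma ae_inj (m : ℕ) : ∀ᵐ a : Fin m → ℝ, Function.Injective a := by
  have : ∀ᵐ a : Fin m → ℝ, ∀ i j, i ≠ j → a i ≠ a j := by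
    rw [ae_all_iff]; intro i
    rw [ae_all_iff]; intro j
    by_cases hij : i = j
    · simp [hij]
    let L : (Fin m → ℝ) →ₗ[ℝ] ℝ := LinearMap.proj (R := ℝ) (φ := fun _ => ℝ) i - LinearMap.proj (R := ℝ) (φ := fun _ => ℝ) j
    have hs : LinearMap.ker L ≠ ⊤ := by
      intro h
      have : Pi.single i (1:ℝ) ∈ LinearMap.ker L := by rw [h]; trivial
      simp [L, hij, Ne.symm hij] at this
    have h0 := Measure.addHaar_submodule (volume : Measure (Fin m → ℝ)) _ hs
    rw [ae_iff]
    refine measure_mono_null ?_ h0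
    intro a ha
    simp [hij] at ha
    simp [L, ha]
  filter_upwards [this] with a ha i j h
  by_contra hne
  exact ha i j hne h

/-- k is a max position -/
def maxSet {m : ℕ} (k : Fin (m+1)) : Set (Fin (m+1) → ℝ) := {a | ∀ j, a (k.succAbove j) ≤ a k}

lemma maxSet_meas {m : ℕ} (k : Fin (m+1)) : MeasurableSet (maxSet k) := by
  have : maxSet k = ⋂ j, {a : Fin (m+1) → ℝ | a (k.succAbove j) ≤ a k} := by
    ext a; simp [maxSet]
  rw [this]
  exact MeasurableSet.iInter fun j => measurableSet_le (measurable_pi_apply _) (measurable_pi_apply _)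

lemma split_sum {m : ℕ} (G : (Fin (m+1) → ℝ) → ENNReal) (a : Fin (m+1) → ℝ) (ha : Function.Injective a) :
    G a = ∑ k, (maxSet k).indicator G a := by
  obtain ⟨k, -, hk⟩ := Finset.exists_max_image Finset.univ a ⟨0, Finset.mem_univ _⟩
  rw [Finset.sum_eq_single k]
  · rw [Set.indicator_of_mem]
    intro j; exact hk _ (Finset.mem_univ _)
  · intro l _ hl
    rw [Set.indicator_of_notMem]
    intro h
    obtain ⟨j, hj⟩ := Fin.exists_succAbove_eq hl.symm
    have h1 := h j
    rw [hj] at h1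
    exact hl (ha (le_antisymm (hk l (Finset.mem_univ _)) h1))
  · simp

lemma main_step (m : ℕ)
    (ih : ∀ φ : (Fin m → ℝ) → ENNReal, Measurable φ →
      ∫⁻ a in AA m, φ (TT m a) = ∫⁻ a in AA m, φ a)
    (φ : (Fin (m+1) → ℝ) → ENNReal) (hφ : Measurable φ) :
      ∫⁻ a in AA (m+1), φ (TT (m+1) a) = ∫⁻ a in AA (m+1), φ a := by
  -- right side
  let Ψ : (Fin m → ℝ) → ENNReal := fun c =>
    ∫⁻ y in Set.Icc 0 (cext c m + 1), φ (ins (Fin.last m) y c)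
  have hφi : Measurable (fun p : ℝ × (Fin m → ℝ) => φ (ins (Fin.last m) p.1 p.2)) :=
    hφ.comp (ins_meas _)
  have hΨ : Measurable Ψ := by
    have hS : MeasurableSet {p : ℝ × (Fin m → ℝ) | 0 ≤ p.1 ∧ p.1 ≤ cext p.2 m + 1} :=
      (measurableSet_le measurable_const measurable_fst).inter
        (measurableSet_le measurable_fst (((cext_meas m).comp measurable_snd).add measurable_const))
    have := (hφi.indicator hS).lintegral_prod_left' (μ := (volume : Measure ℝ))
    convert this using 2 with c
    simp only [Ψ]
    rw [← lintegral_indicator measurableSet_Icc]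
    rfl
  have hR : ∫⁻ a in AA (m+1), φ a = ∫⁻ c in AA m, Ψ c := by
    rw [← lintegral_indicator (AA_meas _), ← lintegral_indicator (AA_meas _),
      lint_ins (Fin.last m) _ (hφ.indicator (AA_meas _))]
    refine lintegral_congr fun c => ?_
    by_cases hc : c ∈ AA m
    · rw [Set.indicator_of_mem hc]
      simp only [Ψ]
      rw [← lintegral_indicator measurableSet_Icc]
      refine lintegral_congr fun y => ?_
      have := ins_mem (Fin.last m) y c (Or.inl rfl)
      simp only [Set.indicator, this, hc, true_and, Fin.val_last, Set.mem_Icc]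
    · rw [Set.indicator_of_notMem hc]
      rw [← lintegral_zero (μ := (volume : Measure ℝ))]
      refine lintegral_congr fun y => ?_
      have := ins_mem (Fin.last m) y c (Or.inl rfl)
      simp only [Set.indicator, this, hc, false_and, if_false]
  rw [hR, ← ih Ψ hΨ]
  -- left side
  let G : (Fin (m+1) → ℝ) → ENNReal := (AA (m+1)).indicator fun a => φ (TT (m+1) a)
  have hG : Measurable G := (hφ.comp (TT_meas _)).indicator (AA_meas _)
  have hGk : ∀ k : Fin (m+1), Measurable ((maxSet k).indicator G) :=
    fun k => hG.indicator (maxSet_meas k)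
  rw [← lintegral_indicator (AA_meas _), ← lintegral_indicator (AA_meas _)]
  have e1 : ∫⁻ a, G a = ∫⁻ a, ∑ k, (maxSet k).indicator G a :=
    lintegral_congr_ae ((ae_inj (m+1)).mono fun a ha => split_sum G a ha)
  change ∫⁻ a, G a = _
  rw [e1, lintegral_finsetSum _ fun k _ => hGk k]
  simp_rw [fun k => lint_ins k _ (hGk k)]
  rw [← lintegral_finsetSum]
  swap
  · intro k _
    exact ((hGk k).comp (ins_meas k)).lintegral_prod_left' (μ := (volume : Measure ℝ))
  refine lintegral_congr fun a => ?_
  by_cases ha : a ∈ AA m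
  · rw [Set.indicator_of_mem ha]
    have hψ : Measurable (fun y => φ (ins (Fin.last m) y (TT m a))) :=
      hφi.comp (measurable_id.prodMk measurable_const)
    have hgm : Measurable (gg a) := by
      unfold gg
      exact Finset.measurable_sum _ fun i _ => sc_cont.measurable.comp (by fun_prop)
    simp only [Ψ]
    rw [← gg_MM, ← oneD (m+1) (cext a) (MM a) (MM_bound a ha) (gg a) rfl, lintegral_map hψ hgm,
      lintegral_finsetSum_measure, Finset.sum_range]
    refine Finset.sum_congr rfl fun k _ => ?_
    rw [← lintegral_indicator measurableSet_Icc]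
    refine lintegral_congr fun x => ?_
    by_cases hx : ∀ j, a j ≤ x
    · have h1 := ins_mem k x a (Or.inr hx)
      have h2 : ins k x a ∈ maxSet k := by intro j; simpa [ins] using hx j
      rw [Set.indicator_of_mem h2]
      simp only [G, Set.indicator, h1, ha, true_and, Set.mem_Icc, MM_le_iff a ha, TT_ins k x a hx]
      simp [hx]
    · have h2 : ins k x a ∉ maxSet k := by
        intro h; apply hx; intro j; simpa [ins] using h j
      rw [Set.indicator_of_notMem h2, Set.indicator_of_notMem]
      intro h
      exact hx ((MM_le_iff a ha x).1 h.1).2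
  · rw [Set.indicator_of_notMem ha]
    refine Finset.sum_eq_zero fun k _ => ?_
    rw [← lintegral_zero (μ := (volume : Measure ℝ))]
    refine lintegral_congr fun x => ?_
    by_cases hx : ∀ j, a j ≤ x
    · have h1 := ins_mem k x a (Or.inr hx)
      simp [Set.indicator, G, h1, ha]
    · have h2 : ins k x a ∉ maxSet k := by
        intro h; apply hx; intro j; simpa [ins] using h j
      rw [Set.indicator_of_notMem h2]

lemma main_ind (m : ℕ) : ∀ φ : (Fin m → ℝ) → ENNReal, Measurable φ →
      ∫⁻ a in AA m, φ (TT m a) = ∫⁻ a in AA m, φ a := by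
  induction m with
  | zero =>
    intro φ _
    refine lintegral_congr fun a => ?_
    congr 1
    exact Subsingleton.elim _ _
  | succ m ih => exact main_step m ih

lemma main_map (m : ℕ) : Measure.map (TT m) (volume.restrict (AA m)) = volume.restrict (AA m) := by
  ext s hs
  rw [← lintegral_indicator_one hs, ← lintegral_indicator_one hs,
    lintegral_map (measurable_one.indicator hs) (TT_meas m)]
  exact main_ind m _ (measurable_one.indicator hs)

/-- `T` is measure preserving: the pushforward of `λ_n` (Lebesgue measure restricted to the
area polytope) under `T` equals `λ_n`. -/
theorem Tmap_measure_preserving (n : ℕ) (hn : 2 ≤ n) :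
    Measure.map (Tmap n) (volume.restrict (areaPoly n)) = volume.restrict (areaPoly n) := by
  obtain ⟨m, rfl⟩ : ∃ m, n = m + 1 := ⟨n - 1, by omega⟩
  exact main_map m
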